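/- Let I = (−ρ, ρ) where 0 < ρ ≤ ∞, and let k be a positive integer. For a function f : I → ℝ, the following are equivalent: (1) for every n ≥ k and every n×n real symmetric matrix A with entries in I having at most k negative eigenvalues, the entrywise transform f[A] has at most k negative eigenvalues; (2) either f is linear of the form f(x) = f(0) + c·x with f(0) ≥ 0 and c > 0, or f is constant, f(x) = d for all x ∈ I for some d ∈ ℝ. -/

import Mathlib

/-- The number of negative eigenvalues (with multiplicity) of a real symmetric
(Hermitian) matrix; junk value `0` if the matrix is not Hermitian. -/
noncomputable def negEigCount {n : Type*} [Fintype n] [DecidableEq n]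
    (A : Matrix n n ℝ) : ℕ :=
  if hA : A.IsHermitian then Nat.card {i // hA.eigenvalues i < 0} else 0

/-- Membership in the interval `(-ρ, ρ)` for `ρ : EReal` (so `ρ = ∞` is allowed). -/
def memI (ρ : EReal) (x : ℝ) : Prop := -ρ < (x : EReal) ∧ (x : EReal) < ρ

open Matrix Finset

section QuadraticForm

variable {n : Type*} [Fintype n] [DecidableEq n]

/-- A real symmetric matrix is diagonalised, as a quadratic form, by its eigenvalues. -/
theorem exists_linearEquiv_dotProduct_mulVec_eq_sum {A : Matrix n n ℝ} (hA : A.IsHermitian) :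
    ∃ T : (n → ℝ) ≃ₗ[ℝ] (n → ℝ), ∀ x,
      x ⬝ᵥ A *ᵥ x = ∑ i, hA.eigenvalues i * (T x i) ^ 2 := by
  let b := hA.eigenvectorBasis
  let e := WithLp.linearEquiv 2 ℝ (n → ℝ)
  refine ⟨e.symm.trans (b.repr.toLinearEquiv.trans e), fun x => ?_⟩
  have hx : x = ∑ i, b.repr (e.symm x) i • e (b i) := by
    have h := congrArg e (b.sum_repr (e.symm x))
    rw [map_sum] at h
    simpa using h.symm
  have hAx : A *ᵥ x = e (∑ i, (hA.eigenvalues i * b.repr (e.symm x) i) • b i) := by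
    conv_lhs => rw [hx]
    rw [← Matrix.mulVecLin_apply, map_sum, map_sum]
    refine Finset.sum_congr rfl fun i _ => ?_
    have h := hA.mulVec_eigenvectorBasis i
    rw [map_smul, map_smul, Matrix.mulVecLin_apply, mul_comm, mul_smul]
    congr 1
  have hinner : ∀ u v : EuclideanSpace ℝ n, inner ℝ u v = e u ⬝ᵥ e v := fun u v => by
    simp [e, PiLp.inner_apply, dotProduct, mul_comm]
  have h1 := hinner (e.symm x) (∑ i, (hA.eigenvalues i * b.repr (e.symm x) i) • b i)
  rw [← hAx, LinearEquiv.apply_symm_apply] at h1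
  rw [← h1, inner_sum]
  refine Finset.sum_congr rfl fun i _ => ?_
  rw [inner_smul_right, real_inner_comm, ← b.repr_apply_apply]
  simp only [LinearEquiv.trans_apply, e]
  change _ = _ * (b.repr (e.symm x) i) ^ 2
  ring

theorem negEigCount_of_isHermitian {A : Matrix n n ℝ} (hA : A.IsHermitian) :
    negEigCount A = Fintype.card {i // hA.eigenvalues i < 0} := by
  rw [negEigCount, dif_pos hA, Nat.card_eq_fintype_card]

/-- The quadratic form of `A` is nonnegative on a subspace of codimension `negEigCount A`. -/
theorem exists_nonneg_on_ker {A : Matrix n n ℝ} (hA : A.IsHermitian) :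
    ∃ L : (n → ℝ) →ₗ[ℝ] (Fin (negEigCount A) → ℝ), ∀ x, L x = 0 → 0 ≤ x ⬝ᵥ A *ᵥ x := by
  obtain ⟨T, hT⟩ := exists_linearEquiv_dotProduct_mulVec_eq_sum hA
  let e := (Fintype.equivFinOfCardEq (negEigCount_of_isHermitian hA).symm).symm
  refine ⟨LinearMap.funLeft ℝ ℝ (fun j => (e j : n)) ∘ₗ T.toLinearMap, fun x hx => ?_⟩
  rw [hT]
  refine Finset.sum_nonneg fun i _ => ?_
  by_cases hi : hA.eigenvalues i < 0
  · have h : T x (e (e.symm ⟨i, hi⟩)) = 0 := congrFun hx (e.symm ⟨i, hi⟩)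
    rw [Equiv.apply_symm_apply] at h
    rw [show T x i = 0 from h]
    simp
  · exact mul_nonneg (not_lt.mp hi) (sq_nonneg _)

/-- A subspace on which the quadratic form is nonnegative has codimension at least
`negEigCount A`. -/
theorem negEigCount_le_of_nonneg_on_ker {A : Matrix n n ℝ} {V : Type*} [AddCommGroup V]
    [Module ℝ V] [FiniteDimensional ℝ V] (hA : A.IsHermitian) (L : (n → ℝ) →ₗ[ℝ] V)
    (hL : ∀ x, L x = 0 → 0 ≤ x ⬝ᵥ A *ᵥ x) : negEigCount A ≤ Module.finrank ℝ V := by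
  obtain ⟨T, hT⟩ := exists_linearEquiv_dotProduct_mulVec_eq_sum hA
  let s := {i // hA.eigenvalues i < 0}
  let E : (s → ℝ) →ₗ[ℝ] (n → ℝ) := Function.ExtendByZero.linearMap ℝ ((↑) : s → n)
  have hE : ∀ c (i : s), E c i = c i := fun c i => Subtype.val_injective.extend_apply _ _ _
  have hE' : ∀ c (i : n), ¬ hA.eigenvalues i < 0 → E c i = 0 := fun c i hi =>
    Function.extend_apply' _ _ _ (by rintro ⟨j, rfl⟩; exact hi j.2)
  have hinj : Function.Injective (L ∘ₗ T.symm.toLinearMap ∘ₗ E) := by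
    rw [← LinearMap.ker_eq_bot, LinearMap.ker_eq_bot']
    intro c hc
    have h := hL _ hc
    rw [hT] at h
    simp only [LinearMap.comp_apply, LinearEquiv.coe_coe, LinearEquiv.apply_symm_apply] at h
    have hterm : ∀ i ∈ (Finset.univ : Finset n), hA.eigenvalues i * E c i ^ 2 ≤ 0 := by
      intro i _
      by_cases hi : hA.eigenvalues i < 0
      · exact mul_nonpos_of_nonpos_of_nonneg hi.le (sq_nonneg _)
      · simp [hE' c i hi]
    have h0 := (Finset.sum_eq_zero_iff_of_nonpos hterm).mp
      (le_antisymm (Finset.sum_nonpos hterm) h)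
    funext i
    have hi := h0 i (Finset.mem_univ _)
    rw [hE] at hi
    simpa [i.2.ne] using hi
  have := LinearMap.finrank_le_finrank_of_injective hinj
  rwa [Module.finrank_fintype_fun_eq_card, ← negEigCount_of_isHermitian hA] at this

/-- A space on which the quadratic form is negative definite has dimension at most
`negEigCount A`. -/
theorem finrank_le_negEigCount_of_neg {A : Matrix n n ℝ} {V : Type*} [AddCommGroup V]
    [Module ℝ V] (hA : A.IsHermitian) (M : V →ₗ[ℝ] (n → ℝ))
    (hM : ∀ v, v ≠ 0 → M v ⬝ᵥ A *ᵥ M v < 0) : Module.finrank ℝ V ≤ negEigCount A := by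
  obtain ⟨L, hL⟩ := exists_nonneg_on_ker hA
  have hinj : Function.Injective (L ∘ₗ M) := by
    rw [← LinearMap.ker_eq_bot, LinearMap.ker_eq_bot']
    intro v hv
    by_contra hne
    exact (hM v hne).not_ge (hL _ hv)
  simpa using LinearMap.finrank_le_finrank_of_injective hinj

theorem negEigCount_submatrix_equiv_le {m : Type*} [Fintype m] [DecidableEq m] {A : Matrix n n ℝ}
    (hA : A.IsHermitian) (e : m ≃ n) : negEigCount (A.submatrix e e) ≤ negEigCount A := by
  obtain ⟨L, hL⟩ := exists_nonneg_on_ker hA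
  have := negEigCount_le_of_nonneg_on_ker (hA.submatrix e)
    (L ∘ₗ LinearMap.funLeft ℝ ℝ e.symm) fun x hx => by
      have h := hL _ hx
      have hform : x ⬝ᵥ A.submatrix e e *ᵥ x = (x ∘ e.symm) ⬝ᵥ A *ᵥ (x ∘ e.symm) := by
        simp only [dotProduct, mulVec, submatrix_apply, Function.comp_apply]
        refine Fintype.sum_equiv e _ _ fun i => ?_
        rw [e.symm_apply_apply]
        congr 1
        exact Fintype.sum_equiv e _ _ fun j => by rw [e.symm_apply_apply]
      rw [hform]
      exact h
  simpa using this

theorem dotProduct_const_add_smul_mulVec {n : Type*} [Fintype n] (A : Matrix n n ℝ) (d c : ℝ)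
    (x : n → ℝ) : x ⬝ᵥ (Matrix.of fun i j => d + c * A i j) *ᵥ x =
      d * (∑ i, x i) ^ 2 + c * (x ⬝ᵥ A *ᵥ x) := by
  have e : (Matrix.of fun i j => d + c * A i j) = (Matrix.of fun _ _ => d) + c • A := by
    ext i j
    simp
  have e2 : x ⬝ᵥ (Matrix.of fun _ _ => d : Matrix n n ℝ) *ᵥ x = d * (∑ i, x i) ^ 2 := by
    simp only [dotProduct, mulVec, of_apply, ← Finset.mul_sum, ← Finset.sum_mul]
    ring
  rw [e, add_mulVec, dotProduct_add, smul_mulVec, dotProduct_smul, e2, smul_eq_mul]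

/-- The matrix `J ⊗ B + I ⊗ D`. -/
def blockSum (N : Type*) [DecidableEq N] {m : Type*} (B D : Matrix m m ℝ) :
    Matrix (N × m) (N × m) ℝ :=
  Matrix.of fun i j => B i.2 j.2 + if i.1 = j.1 then D i.2 j.2 else 0

theorem isHermitian_blockSum {N m : Type*} [DecidableEq N] {B D : Matrix m m ℝ}
    (hB : B.IsSymm) (hD : D.IsSymm) : (blockSum N B D).IsHermitian := by
  ext i j
  simp [blockSum, hB.apply, hD.apply, eq_comm]

theorem dotProduct_blockSum_mulVec {N m : Type*} [Fintype N] [DecidableEq N] [Fintype m]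
    (B D : Matrix m m ℝ) (x : N × m → ℝ) :
    x ⬝ᵥ blockSum N B D *ᵥ x =
      (fun p => ∑ i, x (i, p)) ⬝ᵥ B *ᵥ (fun p => ∑ i, x (i, p)) +
        ∑ i, (fun p => x (i, p)) ⬝ᵥ D *ᵥ (fun p => x (i, p)) := by
  simp only [dotProduct, mulVec, blockSum, of_apply, Fintype.sum_prod_type, add_mul,
    Finset.sum_add_distrib, mul_add, ite_mul, zero_mul]
  congr 1
  · rw [Finset.sum_comm]
    refine Finset.sum_congr rfl fun p _ => ?_
    rw [← Finset.sum_mul, Finset.sum_comm]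
    simp only [Finset.mul_sum]
  · refine Finset.sum_congr rfl fun i _ => Finset.sum_congr rfl fun p _ => ?_
    congr 1
    rw [Finset.sum_comm]
    simp

end QuadraticForm

section Interval

variable {ρ : EReal}

theorem memI_iff_abs_lt {x : ℝ} : memI ρ x ↔ ((|x| : ℝ) : EReal) < ρ := by
  unfold memI
  rcases abs_cases x with ⟨h, hx⟩ | ⟨h, hx⟩ <;> rw [h]
  · refine ⟨fun h => h.2, fun h => ⟨?_, h⟩⟩
    rw [EReal.neg_lt_comm, ← EReal.coe_neg]
    exact lt_of_le_of_lt (by exact_mod_cast (by linarith : -x ≤ x)) h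
  · rw [EReal.neg_lt_comm, ← EReal.coe_neg]
    refine ⟨fun h => h.1, fun h => ⟨h, ?_⟩⟩
    exact lt_of_le_of_lt (by exact_mod_cast (by linarith : x ≤ -x)) h

theorem memI.of_abs_le {x y : ℝ} (hx : memI ρ x) (h : |y| ≤ |x|) : memI ρ y :=
  memI_iff_abs_lt.mpr (lt_of_le_of_lt (by exact_mod_cast h) (memI_iff_abs_lt.mp hx))

theorem exists_pos_memI (hρ : 0 < ρ) : ∃ a : ℝ, 0 < a ∧ memI ρ a := by
  obtain ⟨a, ha, haρ⟩ := EReal.lt_iff_exists_real_btwn.mp hρ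
  have ha' : 0 < a := by exact_mod_cast ha
  exact ⟨a, ha', memI_iff_abs_lt.mpr (by rwa [abs_of_pos ha'])⟩

end Interval

/-- On all index types of size at least `k`, the entrywise map `f` sends symmetric matrices with
entries in `(-ρ, ρ)` and at most `k` negative eigenvalues to matrices with at most `k` negative
eigenvalues. -/
def PreservesNegEigCountLE (ρ : EReal) (k : ℕ) (f : ℝ → ℝ) : Prop :=
  ∀ (ι : Type) [Fintype ι] [DecidableEq ι], k ≤ Fintype.card ι → ∀ A : Matrix ι ι ℝ,
    A.IsHermitian → (∀ i j, memI ρ (A i j)) → negEigCount A ≤ k → negEigCount (A.map f) ≤ k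

theorem preservesNegEigCountLE_of_fin {ρ : EReal} {k : ℕ} {f : ℝ → ℝ}
    (H : ∀ n : ℕ, k ≤ n → ∀ A : Matrix (Fin n) (Fin n) ℝ,
      A.IsSymm → (∀ i j, memI ρ (A i j)) → negEigCount A ≤ k →
      ((A.map f).IsSymm ∧ negEigCount (A.map f) ≤ k)) : PreservesNegEigCountLE ρ k f := by
  intro ι _ _ hk A hA hI hneg
  let e := Fintype.equivFin ι
  have hS : (A.submatrix e.symm e.symm).IsHermitian := hA.submatrix _
  obtain ⟨h1, h2⟩ := H _ hk (A.submatrix e.symm e.symm) hS (fun i j => hI _ _)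
    ((negEigCount_submatrix_equiv_le hA e.symm).trans hneg)
  have h := negEigCount_submatrix_equiv_le (A := (A.submatrix e.symm e.symm).map f) h1 e
  have hmap : ((A.submatrix e.symm e.symm).map f).submatrix e e = A.map f := by
    ext i j
    simp
  rw [hmap] at h
  exact h.trans h2

namespace PreservesNegEigCountLE

variable {ρ : EReal} {k : ℕ} {f : ℝ → ℝ}

/-- Loewner monotonicity of `f` along the all-ones direction, at a matrix whose quadratic form is
nonnegative on a hyperplane. -/
theorem dotProduct_increment_nonneg (H : PreservesNegEigCountLE ρ k f) (hk : 1 ≤ k)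
    {m : Type} [Fintype m] [DecidableEq m] [Nonempty m] {B : Matrix m m ℝ} (hB : B.IsSymm) {h : ℝ}
    (hh : 0 ≤ h) (hI : ∀ p q, memI ρ (B p q)) (hI' : ∀ p q, memI ρ (B p q + h))
    (φ : (m → ℝ) →ₗ[ℝ] ℝ) (hφ : ∀ x, φ x = 0 → 0 ≤ x ⬝ᵥ B *ᵥ x) (v : m → ℝ) :
    0 ≤ v ⬝ᵥ (Matrix.of fun p q => f (B p q + h) - f (B p q)) *ᵥ v := by
  set D : Matrix m m ℝ := Matrix.of fun p q => f (B p q + h) - f (B p q) with hDdef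
  by_contra! hneg
  let N := Fin (k + 2)
  let J : Matrix m m ℝ := Matrix.of fun _ _ => h
  have hJ : J.IsSymm := rfl
  have hD : D.IsSymm := by
    ext p q
    simp [hDdef, hB.apply]
  have hBf : (B.map f).IsSymm := hB.map f
  have hA : (blockSum N B J).IsHermitian := isHermitian_blockSum hB hJ
  have hAf : (blockSum N B J).map f = blockSum N (B.map f) D := by
    ext i j
    by_cases hij : i.1 = j.1 <;> simp [blockSum, J, hDdef, hij]
  have hcard : k ≤ Fintype.card (N × m) := by
    rw [Fintype.card_prod, Fintype.card_fin]
    nlinarith [Fintype.card_pos (α := m)]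
  let S : (N × m → ℝ) →ₗ[ℝ] (m → ℝ) := ∑ i, LinearMap.funLeft ℝ ℝ fun p => (i, p)
  have hS : ∀ x, S x = fun p => ∑ i, x (i, p) := fun x => by
    funext p
    simp [S, LinearMap.funLeft_apply]
  have hAk : negEigCount (blockSum N B J) ≤ k := by
    refine le_trans ?_ hk
    rw [← Module.finrank_self ℝ]
    refine negEigCount_le_of_nonneg_on_ker hA (φ ∘ₗ S) fun x hx => ?_
    rw [dotProduct_blockSum_mulVec, ← hS]
    refine add_nonneg (hφ _ hx) (Finset.sum_nonneg fun i _ => ?_)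
    have : (fun p => x (i, p)) ⬝ᵥ J *ᵥ (fun p => x (i, p)) = h * (∑ p, x (i, p)) ^ 2 := by
      simp only [dotProduct, mulVec, J, of_apply, ← Finset.mul_sum, ← Finset.sum_mul]
      ring
    rw [this]
    positivity
  have hle := H (N × m) hcard _ hA (fun i j => by
    by_cases hij : i.1 = j.1
    · simpa [blockSum, J, hij] using hI' i.2 j.2
    · simpa [blockSum, J, hij] using hI i.2 j.2) hAk
  rw [hAf] at hle
  let W : (Fin (k + 1) → ℝ) →ₗ[ℝ] (N → ℝ) :=
    { toFun := fun u => Fin.cons (-∑ i, u i) u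
      map_add' := fun u w => by
        funext i
        refine Fin.cases ?_ (fun i => ?_) i <;> simp [Finset.sum_add_distrib, add_comm]
      map_smul' := fun c u => by
        funext i
        refine Fin.cases ?_ (fun i => ?_) i <;> simp [Finset.mul_sum] }
  have hW0 : ∀ u, ∑ i, W u i = 0 := fun u => by
    simp [W, N, Fin.sum_univ_succ]
  let M : (Fin (k + 1) → ℝ) →ₗ[ℝ] (N × m → ℝ) :=
    { toFun := fun u i => W u i.1 * v i.2
      map_add' := fun u w => by
        funext i
        simp [add_mul]
      map_smul' := fun c u => by
        funext i
        simp [mul_assoc] }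
  have hge := finrank_le_negEigCount_of_neg (isHermitian_blockSum (N := N) hBf hD) M
    fun u hu => by
      rw [dotProduct_blockSum_mulVec]
      have h0 : (fun p => ∑ i, M u (i, p)) = 0 := by
        funext p
        change ∑ i, W u i * v p = 0
        rw [← Finset.sum_mul, hW0, zero_mul]
      have h1 : ∀ i, (fun p => M u (i, p)) = W u i • v := fun i => rfl
      simp only [h0, h1, zero_dotProduct, zero_add, mulVec_smul, smul_dotProduct,
        dotProduct_smul, smul_eq_mul, ← mul_assoc, ← Finset.sum_mul]
      refine mul_neg_of_pos_of_neg ?_ hneg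
      obtain ⟨i, hi⟩ := Function.ne_iff.mp hu
      refine Finset.sum_pos' (fun i _ => mul_self_nonneg _) ⟨i.succ, Finset.mem_univ _, ?_⟩
      exact mul_self_pos.mpr hi
  rw [Module.finrank_fintype_fun_eq_card, Fintype.card_fin] at hge
  omega

/-- The increments `f (x + h) - f x` do not depend on `x` and are nonnegative for `h ≥ 0`. -/
theorem increment_eq (H : PreservesNegEigCountLE ρ k f) (hk : 1 ≤ k) {x h : ℝ} (hh : 0 ≤ h)
    (hIx : memI ρ x) (hIh : memI ρ h) (hIxh : memI ρ (x + h)) :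
    f (x + h) - f x = f h - f 0 ∧ f 0 ≤ f h := by
  have h0 : memI ρ 0 := hIx.of_abs_le (by simp)
  have key : ∀ b c : ℝ, memI ρ b → memI ρ c → memI ρ (b + h) → memI ρ (c + h) → ∀ s : ℝ,
      0 ≤ (f h - f 0) + 2 * s * (f (b + h) - f b) + s ^ 2 * (f (c + h) - f c) := by
    intro b c hb hc hbh hch s
    have := H.dotProduct_increment_nonneg hk (B := !![0, b; b, c]) (h := h)
      (by ext i j; fin_cases i <;> fin_cases j <;> rfl) hh
      (by intro i j; fin_cases i <;> fin_cases j <;> simpa)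
      (by intro i j; fin_cases i <;> fin_cases j <;> simpa)
      (LinearMap.proj 1)
      (by
        intro y hy
        have hy' : y 1 = 0 := hy
        simp [dotProduct, mulVec, Fin.sum_univ_two, hy'])
      ![1, s]
    simp [dotProduct, mulVec, Fin.sum_univ_two] at this
    linarith
  have hIh' : memI ρ (0 + h) := by rwa [zero_add]
  have h1 := key x 0 hIx h0 hIxh hIh' 1
  have h2 := key x 0 hIx h0 hIxh hIh' (-1)
  have h3 := key 0 x h0 hIx hIh' hIxh (-1)
  simp only [zero_add] at h1 h2 h3
  constructor <;> linarith

/-- The function `f - f 0` is linear on `(-ρ, ρ)`. -/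
theorem exists_eq_add_mul (H : PreservesNegEigCountLE ρ k f) (hk : 1 ≤ k) (hρ : 0 < ρ) :
    ∃ c : ℝ, 0 ≤ c ∧ ∀ x, memI ρ x → f x = f 0 + c * x := by
  obtain ⟨a, ha, hIa⟩ := exists_pos_memI hρ
  have h0 : memI ρ 0 := hIa.of_abs_le (by simp)
  have hmono : ∀ x, 0 ≤ x → memI ρ x → f 0 ≤ f x := fun x hx hI =>
    (H.increment_eq hk hx h0 hI (by rwa [zero_add])).2
  have hadd : ∀ x y, 0 ≤ y → memI ρ x → memI ρ y → memI ρ (x + y) →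
      f (x + y) - f x = f y - f 0 := fun x y hy hx hIy hxy =>
    (H.increment_eq hk hy hx hIy hxy).1
  have hle : ∀ {x y : ℝ}, 0 ≤ y → y ≤ x → memI ρ x → memI ρ y := fun hy hyx hx =>
    hx.of_abs_le (by rwa [abs_of_nonneg hy, abs_of_nonneg (hy.trans hyx)])
  have hmul : ∀ (n : ℕ) (y : ℝ), 0 ≤ y → memI ρ (n * y) → f (n * y) - f 0 = n * (f y - f 0) := by
    intro n y hy
    induction n with
    | zero => simp
    | succ n ih =>
      intro hI
      push_cast at hI ⊢
      rw [add_mul, one_mul] at hI ⊢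
      have hny : 0 ≤ (n : ℝ) * y := by positivity
      have hI1 := hle hny (by linarith) hI
      have h1 := ih hI1
      have h2 := hadd _ _ hy hI1 (hle hy (by linarith) hI) hI
      linarith
  have hpos : ∀ x, 0 ≤ x → memI ρ x → f x = f 0 + (f a - f 0) / a * x := by
    intro x hx hIx
    have hbound : ∀ n : ℕ, |f x - f 0 - (f a - f 0) / a * x| ≤ (f a - f 0) / (n + 1) := by
      intro n
      set y := a / (n + 1) with hy
      have hn : (0 : ℝ) < n + 1 := by positivity
      have hypos : 0 < y := by positivity
      have hya : (n + 1) * y = a := by rw [hy]; field_simp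
      have hIy : memI ρ y := hle hypos.le (by rw [hy]; exact div_le_self ha.le (by linarith)) hIa
      have hfy : f a - f 0 = (n + 1) * (f y - f 0) := by
        have := hmul (n + 1) y hypos.le (by push_cast; rwa [hya])
        push_cast at this
        rwa [hya] at this
      set q := ⌊x / y⌋₊
      have hq1 : q * y ≤ x := (le_div_iff₀ hypos).mp (Nat.floor_le (by positivity))
      have hq2 : x < (q + 1) * y := (div_lt_iff₀ hypos).mp (Nat.lt_floor_add_one _)
      have hq0 : 0 ≤ q * y := by positivity
      have hIq : memI ρ (q * y) := hle hq0 hq1 hIx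
      have hfq := hmul q y hypos.le hIq
      have hr0 : 0 ≤ x - q * y := by linarith
      have hry : x - q * y ≤ y := by linarith
      have hIr : memI ρ (x - q * y) := hle hr0 hry hIy
      have hfr := hadd (q * y) (x - q * y) hr0 hIq hIr (by rwa [add_sub_cancel])
      rw [add_sub_cancel] at hfr
      have hr1 := hmono _ hr0 hIr
      have hr2 : f (x - q * y) ≤ f y := by
        have h1 := hadd (x - q * y) (y - (x - q * y)) (by linarith) hIr
          (hle (by linarith) (by linarith) hIy) (by rwa [add_sub_cancel])
        rw [add_sub_cancel] at h1
        have h2 := hmono (y - (x - q * y)) (by linarith) (hle (by linarith) (by linarith) hIy)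
        linarith
      have hG := hmono y hypos.le hIy
      have e1 : (f a - f 0) / a * x = (f y - f 0) * (x / y) := by
        rw [hfy, ← hya]; field_simp
      have e2 : (f a - f 0) / (n + 1) = f y - f 0 := by
        rw [hfy]; field_simp
      have hxy1 : (q : ℝ) ≤ x / y := Nat.floor_le (by positivity)
      have hxy2 : x / y ≤ q + 1 := (Nat.lt_floor_add_one _).le
      have hm1 := mul_le_mul_of_nonneg_left hxy1 (sub_nonneg.mpr hG)
      have hm2 := mul_le_mul_of_nonneg_left hxy2 (sub_nonneg.mpr hG)
      rw [e1, e2, abs_le]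
      constructor <;> linarith
    have hlim : Filter.Tendsto (fun n : ℕ => (f a - f 0) / ((n : ℝ) + 1)) Filter.atTop
        (nhds 0) := by
      have := (tendsto_one_div_add_atTop_nhds_zero_nat (𝕜 := ℝ)).const_mul (f a - f 0)
      simpa [div_eq_mul_inv] using this
    have := abs_nonpos_iff.mp (ge_of_tendsto' hlim hbound)
    linarith
  refine ⟨(f a - f 0) / a, div_nonneg (sub_nonneg.mpr (hmono a ha.le hIa)) ha.le, fun x hx => ?_⟩
  rcases le_total 0 x with h | h
  · exact hpos x h hx
  · have hIn : memI ρ (-x) := hx.of_abs_le (by rw [abs_neg])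
    have h1 := hpos (-x) (by linarith) hIn
    have h2 := hadd x (-x) (by linarith) hx hIn (by rwa [add_neg_cancel])
    rw [add_neg_cancel] at h2
    linarith

theorem apply_zero_nonneg (H : PreservesNegEigCountLE ρ k f) (hρ : 0 < ρ) {c : ℝ} (hc : 0 < c)
    (hf : ∀ x, memI ρ x → f x = f 0 + c * x) : 0 ≤ f 0 := by
  by_contra! hneg
  obtain ⟨a, ha, hIa⟩ := exists_pos_memI hρ
  let d : Option (Fin k) → ℝ := fun i => i.elim 0 fun _ => -a
  let A : Matrix (Option (Fin k)) (Option (Fin k)) ℝ := diagonal d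
  have hA : A.IsHermitian := isHermitian_diagonal d
  have hform : ∀ x, x ⬝ᵥ A *ᵥ x = -a * ∑ i, x (some i) ^ 2 := fun x => by
    simp only [A, dotProduct, mulVec_diagonal, Fintype.sum_option, d, Option.elim, zero_mul,
      mul_zero, zero_add, Finset.mul_sum]
    exact Finset.sum_congr rfl fun i _ => by ring
  have hI : ∀ i j, memI ρ (A i j) := by
    intro i j
    refine hIa.of_abs_le ?_
    by_cases hij : i = j
    · cases i <;> simp [A, d, ← hij]
    · simp [A, hij]
  have hAk : negEigCount A ≤ k := by
    have := negEigCount_le_of_nonneg_on_ker hA (LinearMap.funLeft ℝ ℝ (some : Fin k → _))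
      fun x hx => by
        have : ∀ i, x (some i) = 0 := fun i => congrFun hx i
        simp [hform, this]
    simpa using this
  have hle := H _ (by simp) A hA hI hAk
  have hAf : (A.map f).IsHermitian := IsSymm.map hA f
  have hge := finrank_le_negEigCount_of_neg hAf LinearMap.id fun x hx => by
    rw [LinearMap.id_apply]
    have e : A.map f = Matrix.of fun i j => f 0 + c * A i j := by
      ext i j
      simp [hf _ (hI i j)]
    rw [e, dotProduct_const_add_smul_mulVec, hform]
    by_cases hs : ∀ i, x (some i) = 0
    · have hx0 : x none ≠ 0 := fun h0 => hx (by
        funext i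
        cases i with
        | none => exact h0
        | some i => exact hs i)
      simp only [Fintype.sum_option, hs]
      have : 0 < x none ^ 2 := by positivity
      simp
      nlinarith
    · push Not at hs
      obtain ⟨i, hi⟩ := hs
      have h1 : 0 < ∑ i, x (some i) ^ 2 :=
        Finset.sum_pos' (fun i _ => sq_nonneg _) ⟨i, Finset.mem_univ _, by positivity⟩
      have h2 : f 0 * (∑ i, x i) ^ 2 ≤ 0 := mul_nonpos_of_nonpos_of_nonneg hneg.le (sq_nonneg _)
      have h3 : 0 < c * (a * ∑ i, x (some i) ^ 2) := by positivity
      linarith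
  rw [Module.finrank_fintype_fun_eq_card, Fintype.card_option, Fintype.card_fin] at hge
  omega

end PreservesNegEigCountLE

/-- Theorem 1.4: `f[-]` sends matrices with entries in `(-ρ,ρ)` having at most `k` negative
eigenvalues to matrices with at most `k` negative eigenvalues (for positive `k`) if and only
if `f` is linear of the form `f(x) = f(0) + c x` with `f(0) ≥ 0` and `c > 0`, or constant. -/
theorem atMostK_preserver_iff (ρ : EReal) (hρ : 0 < ρ) (k : ℕ) (hk : 1 ≤ k) (f : ℝ → ℝ) :
    (∀ n : ℕ, k ≤ n → ∀ A : Matrix (Fin n) (Fin n) ℝ,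
        A.IsSymm → (∀ i j, memI ρ (A i j)) → negEigCount A ≤ k →
        ((A.map f).IsSymm ∧ negEigCount (A.map f) ≤ k)) ↔
    ((0 ≤ f 0 ∧ ∃ c : ℝ, 0 < c ∧ ∀ x : ℝ, memI ρ x → f x = f 0 + c * x) ∨
     (∃ d : ℝ, ∀ x : ℝ, memI ρ x → f x = d)) := by
  constructor
  · intro H
    have H' := preservesNegEigCountLE_of_fin H
    obtain ⟨c, hc, hf⟩ := H'.exists_eq_add_mul hk hρ
    rcases hc.eq_or_lt with rfl | hc
    · exact Or.inr ⟨f 0, fun x hx => by simp [hf x hx]⟩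
    · exact Or.inl ⟨H'.apply_zero_nonneg hρ hc hf, c, hc, hf⟩
  · intro h n _ A hA hI hneg
    have hAf : (A.map f).IsHermitian := hA.map f
    refine ⟨hAf, ?_⟩
    rcases h with ⟨h0, c, hc, hf⟩ | ⟨d, hf⟩
    · have e : A.map f = Matrix.of fun i j => f 0 + c * A i j := by
        ext i j
        simp [hf _ (hI i j)]
      obtain ⟨L, hL⟩ := exists_nonneg_on_ker (A := A) hA
      refine le_trans ?_ hneg
      simpa using negEigCount_le_of_nonneg_on_ker hAf L fun x hx => by
        rw [e, dotProduct_const_add_smul_mulVec]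
        have := hL x hx
        positivity
    · have e : A.map f = Matrix.of fun i j => d + 0 * A i j := by
        ext i j
        simp [hf _ (hI i j)]
      refine le_trans ?_ hk
      rw [← Module.finrank_self ℝ]
      refine negEigCount_le_of_nonneg_on_ker hAf (∑ i, LinearMap.proj i) fun x hx => ?_
      have hx' : ∑ i, x i = 0 := by simpa using hx
      rw [e, dotProduct_const_add_smul_mulVec, hx']
      simp
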